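/- arXiv:1905.04731 — 3 statements merged into one kernel-verified Lean document; each statement's English description precedes it below -/
import Mathlib

section
/- Let R be a commutative Noetherian local ring and let 𝒞 be a class of finitely generated R-modules satisfying: (1) R ∈ 𝒞; (2) for every finitely generated module X and every surjective R-linear map π : F → X with F finitely generated free, X ∈ 𝒞 if and only if ker π ∈ 𝒞; (3) for every finitely generated module X, X ∈ 𝒞 if and only if X ⊕ R ∈ 𝒞. Suppose a finitely generated module N admits a reducing sequence K_0 = N, K_1, …, K_r with K_r ∈ 𝒞. Then every first syzygy of N (the kernel of any surjection from a finitely generated free module onto N) admits a reducing sequence whose last module lies in 𝒞. -/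
open CategoryTheory

universe u

variable (R : Type u) [CommRing R]

/-- `SES R A B C` : there is a short exact sequence `0 → A → B → C → 0` of `R`-modules. -/
def SES (A B C : ModuleCat.{u} R) : Prop :=
  ∃ (f : A →ₗ[R] B) (g : B →ₗ[R] C),
    Function.Injective f ∧ Function.Surjective g ∧ LinearMap.range f = LinearMap.ker g

/-- A finitely generated free module. -/
def IsFinFree (F : ModuleCat.{u} R) : Prop :=
  Module.Finite R F ∧ Module.Free R F

/-- `IsSyzygy R n S K` : `S` is an `n`-th syzygy of `K`, i.e. there is an exact sequence
`0 → S → F_{n-1} → ⋯ → F_0 → K → 0` with each `F_j` finitely generated free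
(for `n = 0` this just means `S ≅ K`). -/
def IsSyzygy : ℕ → ModuleCat.{u} R → ModuleCat.{u} R → Prop
  | 0, S, K => Nonempty (S ≃ₗ[R] K)
  | n + 1, S, K => ∃ T F : ModuleCat.{u} R, IsSyzygy n T K ∧ IsFinFree R F ∧ SES R S F T

/-- The direct sum `M^{⊕ a}`. -/
def MPow (M : ModuleCat.{u} R) (a : ℕ) : ModuleCat.{u} R := ModuleCat.of R (Fin a → M)

/-- `IsReducingSeq R K` : the finitely generated modules `K 0, …, K r` form a reducing
sequence, i.e. there are positive integers `a i, b i, n i` and short exact sequences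
`0 → (K i)^{⊕ a i} → K (i+1) → S i → 0` where `S i` is an `(n i)`-th syzygy
of `(K i)^{⊕ b i}`. -/
def IsReducingSeq {r : ℕ} (K : Fin (r + 1) → ModuleCat.{u} R) : Prop :=
  (∀ i, Module.Finite R (K i)) ∧
  ∃ a b n : Fin r → ℕ,
    (∀ i, 0 < a i) ∧ (∀ i, 0 < b i) ∧ (∀ i, 0 < n i) ∧
    ∀ i : Fin r, ∃ S : ModuleCat.{u} R,
      IsSyzygy R (n i) S (MPow R (K i.castSucc) (b i)) ∧
      SES R (MPow R (K i.castSucc) (a i)) (K i.succ) S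

/-- `ExtVanishes R M N i` : the `R`-module `Ext^i_R(M, N)` is zero. -/
def ExtVanishes (M N : ModuleCat.{u} R) (i : ℕ) : Prop :=
  Subsingleton (((Ext R (ModuleCat.{u} R) i).obj (Opposite.op M)).obj N)

/-- A totally reflexive module. -/
def IsTotallyReflexive (M : ModuleCat.{u} R) : Prop :=
  Function.Bijective (Module.Dual.eval R M) ∧
  ∀ i : ℕ, 1 ≤ i →
    ExtVanishes R M (ModuleCat.of R R) i ∧
    ExtVanishes R (ModuleCat.of R (Module.Dual R M)) (ModuleCat.of R R) i

/-- `ResolvedBy R P m M` : there is an exact sequence `0 → G_m → ⋯ → G_0 → M → 0`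
in which each `G_j` satisfies `P`. -/
def ResolvedBy (P : ModuleCat.{u} R → Prop) : ℕ → ModuleCat.{u} R → Prop
  | 0, M => ∃ G : ModuleCat.{u} R, P G ∧ Nonempty (G ≃ₗ[R] M)
  | m + 1, M => ∃ G S : ModuleCat.{u} R, P G ∧ SES R S G M ∧ ResolvedBy P m S

/-- Finite Gorenstein dimension. -/
def FiniteGdim (M : ModuleCat.{u} R) : Prop :=
  ∃ m : ℕ, ResolvedBy R (IsTotallyReflexive R) m M

/-- Finite projective dimension. -/
def FinitePd (M : ModuleCat.{u} R) : Prop :=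
  ∃ m : ℕ, ResolvedBy R (fun G => Module.Projective R G) m M

/-- `HasRedSeqTo R P M` : `M` admits a reducing sequence `K_0 = M, K_1, …, K_r`
whose last module `K_r` satisfies `P`. -/
def HasRedSeqTo (P : ModuleCat.{u} R → Prop) (M : ModuleCat.{u} R) : Prop :=
  ∃ (r : ℕ) (K : Fin (r + 1) → ModuleCat.{u} R),
    K 0 = M ∧ IsReducingSeq R K ∧ P (K (Fin.last r))

/-- Finite reducing Gorenstein dimension. -/
def FiniteRedGdim (M : ModuleCat.{u} R) : Prop :=
  HasRedSeqTo R (FiniteGdim R) M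

/-- Finite reducing projective dimension. -/
def FiniteRedPd (M : ModuleCat.{u} R) : Prop :=
  HasRedSeqTo R (FinitePd R) M

/-- One step of a reducing sequence. -/
def RedStep (R : Type u) [CommRing R] (M M' : ModuleCat.{u} R) : Prop :=
  ∃ a b n : ℕ, 0 < a ∧ 0 < b ∧ 0 < n ∧ ∃ S : ModuleCat.{u} R,
    IsSyzygy R n S (MPow R M b) ∧ SES R (MPow R M a) M' S

theorem hasRedSeqTo_cons (R : Type u) [CommRing R] (P : ModuleCat.{u} R → Prop)
    (M M' : ModuleCat.{u} R) (hM : Module.Finite R M) (hs : RedStep R M M')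
    (h : HasRedSeqTo R P M') : HasRedSeqTo R P M := by
  obtain ⟨r, K, rfl, ⟨hfin, a, b, n, ha, hb, hn, hS⟩, hP⟩ := h
  obtain ⟨a0, b0, n0, ha0, hb0, hn0, hS0⟩ := hs
  refine ⟨r + 1, Fin.cons M K, rfl, ⟨?_, Fin.cons a0 a, Fin.cons b0 b, Fin.cons n0 n,
    ?_, ?_, ?_, ?_⟩, ?_⟩
  · intro i
    refine Fin.cases ?_ (fun i => ?_) i
    · exact hM
    · exact hfin i
  · intro i
    refine Fin.cases ?_ (fun i => ?_) i
    · exact ha0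
    · exact ha i
  · intro i
    refine Fin.cases ?_ (fun i => ?_) i
    · exact hb0
    · exact hb i
  · intro i
    refine Fin.cases ?_ (fun i => ?_) i
    · exact hn0
    · exact hn i
  · intro i
    refine Fin.cases ?_ (fun i => ?_) i
    · exact hS0
    · exact hS i
  · exact hP

theorem syz_one (R : Type u) [CommRing R] [IsNoetherianRing R]
    (S F T G' B : ModuleCat.{u} R) (hF : IsFinFree R F) (hG' : IsFinFree R G')
    (h : SES R S F T) (h' : SES R B G' T) :
    ∃ G D H : ModuleCat.{u} R, IsFinFree R G ∧ SES R D G S ∧ IsFinFree R H ∧ SES R D H B := by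
  obtain ⟨f, g, hf, hg, hfg⟩ := h
  obtain ⟨i, q, hi, hq, hiq⟩ := h'
  obtain ⟨_, _⟩ := hF
  obtain ⟨_, _⟩ := hG'
  have : Module.Finite R S := Module.Finite.of_injective f hf
  obtain ⟨m, c, hc⟩ := Module.Finite.exists_fin' R S
  obtain ⟨s, hs⟩ := Module.projective_lifting_property q g hq
  obtain ⟨t, ht⟩ := Module.projective_lifting_property g q hg
  have hs' : ∀ x, q (s x) = g x := fun x => LinearMap.congr_fun hs x
  have ht' : ∀ x, g (t x) = q x := fun x => LinearMap.congr_fun ht x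
  have hgf : ∀ x, g (f x) = 0 := fun x => by
    have : f x ∈ LinearMap.ker g := hfg ▸ LinearMap.mem_range_self f x
    exact this
  have hgf' : ∀ x, g x = 0 → ∃ y, f y = x := fun x hx => by
    have : x ∈ LinearMap.range f := hfg ▸ hx
    exact this
  have hqi : ∀ x, q (i x) = 0 := fun x => by
    have : i x ∈ LinearMap.ker q := hiq ▸ LinearMap.mem_range_self i x
    exact this
  have hqi' : ∀ x, q x = 0 → ∃ y, i y = x := fun x hx => by
    have : x ∈ LinearMap.range i := hiq ▸ hx
    exact this
  -- the lift d
  obtain ⟨δ, hδ⟩ : ∃ δ : F →ₗ[R] S, ∀ x, f (δ x) = x - t (s x) :=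
    ⟨LinearMap.codRestrictOfInjective (LinearMap.id - t ∘ₗ s) f hf (fun x => by
      obtain ⟨y, hy⟩ := hgf' (x - t (s x)) (by simp [ht', hs'])
      exact ⟨y, by simpa using hy⟩), fun x => by simp⟩
  obtain ⟨d, hd⟩ := Module.projective_lifting_property c δ hc
  have hd' : ∀ x, c (d x) = δ x := fun x => LinearMap.congr_fun hd x
  let e : ((Fin m → R) × G') →ₗ[R] G' :=
    LinearMap.snd R _ _ - s ∘ₗ (t ∘ₗ LinearMap.snd R _ _ + f ∘ₗ c ∘ₗ LinearMap.fst R _ _)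
  have he : ∀ x y, e (x, y) = y - s (t y + f (c x)) := fun x y => by simp [e]
  obtain ⟨ε, hε⟩ : ∃ ε : ((Fin m → R) × G') →ₗ[R] B, ∀ x, i (ε x) = e x :=
    ⟨LinearMap.codRestrictOfInjective e i hi (fun x => by
      obtain ⟨x, y⟩ := x
      obtain ⟨z, hz⟩ := hqi' (e (x, y)) (by rw [he]; simp [ht', hs', hgf])
      exact ⟨z, hz⟩), fun x => by simp⟩
  refine ⟨ModuleCat.of R ((Fin m → R) × F), ModuleCat.of R (LinearMap.ker c × F),
    ModuleCat.of R ((Fin m → R) × G'), ⟨?_, ?_⟩, ⟨?_, ?_, ?_, ?_, ?_⟩, ⟨?_, ?_⟩,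
    ⟨?_, ε, ?_, ?_, ?_⟩⟩
  · change Module.Finite R ((Fin m → R) × F); infer_instance
  · change Module.Free R ((Fin m → R) × F); infer_instance
  · exact LinearMap.prodMap (LinearMap.ker c).subtype LinearMap.id
  · exact c ∘ₗ LinearMap.fst R _ _
  · rintro ⟨⟨a, ha⟩, x⟩ ⟨⟨b, hb⟩, y⟩ h
    simpa using h
  · intro y
    obtain ⟨x, hx⟩ := hc y
    exact ⟨(x, 0), hx⟩
  · ext ⟨x, y⟩
    constructor
    · rintro ⟨⟨⟨a, ha⟩, z⟩, h⟩
      have h1 : a = x := congrArg Prod.fst h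
      subst h1
      exact ha
    · intro h
      exact ⟨(⟨x, h⟩, y), rfl⟩
  · change Module.Finite R ((Fin m → R) × G'); infer_instance
  · change Module.Free R ((Fin m → R) × G'); infer_instance
  · exact LinearMap.prod
      ((LinearMap.ker c).subtype ∘ₗ LinearMap.fst R _ _ + d ∘ₗ LinearMap.snd R _ _)
      (s ∘ₗ LinearMap.snd R _ _)
  · refine (injective_iff_map_eq_zero' _).mpr ?_ |> fun h => h
    rintro ⟨⟨a, ha⟩, x⟩
    constructor
    · intro h
      have h1 : a + d x = 0 := congrArg Prod.fst h
      have h2 : s x = 0 := congrArg Prod.snd h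
      have h3 : c (a + d x) = 0 := by rw [h1, map_zero]
      have ha' : c a = 0 := ha
      rw [map_add, ha', zero_add, hd'] at h3
      have h4 := hδ x
      rw [h3, h2] at h4
      have h5 : x = 0 := by simpa using h4.symm
      subst h5
      have h6 : a = 0 := by simpa using h1
      subst h6
      rfl
    · intro h
      rw [h, map_zero]
  · intro b
    obtain ⟨σ, hσ⟩ := hgf' (t (i b)) (by rw [ht', hqi])
    obtain ⟨x, hx⟩ := hc (-σ)
    refine ⟨(x, i b), hi ?_⟩
    rw [hε, he, hx, map_neg, hσ]
    simp
  · ext ⟨x, y⟩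
    constructor
    · rintro ⟨⟨⟨a, ha⟩, z⟩, h⟩
      have h1 : a + d z = x := congrArg Prod.fst h
      have h2 : s z = y := congrArg Prod.snd h
      have ha' : c a = 0 := ha
      refine hi ?_
      rw [hε, map_zero, he, ← h1, ← h2, map_add c, ha', hd', zero_add, hδ]
      simp
    · intro h
      have h' : ε (x, y) = 0 := h
      have h1 := hε (x, y)
      rw [h', map_zero, he] at h1
      have h2 : y = s (t y + f (c x)) := (sub_eq_zero.mp h1.symm)
      refine ⟨(⟨x - d (t y + f (c x)), ?_⟩, t y + f (c x)), ?_⟩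
      · rw [LinearMap.mem_ker, map_sub, hd', sub_eq_zero]
        apply hf
        rw [hδ, ← h2]
        simp
      · refine Prod.ext ?_ h2.symm
        change x - d (t y + f (c x)) + d (t y + f (c x)) = x
        simp

theorem syz_comparison (R : Type u) [CommRing R] [IsNoetherianRing R]
    (A E X : ModuleCat.{u} R) (hE : IsFinFree R E) (h : SES R A E X) (n : ℕ) :
    ∀ S : ModuleCat.{u} R, IsSyzygy R n S X →
    ∃ G B : ModuleCat.{u} R, IsFinFree R G ∧ SES R B G S ∧ IsSyzygy R n B A := by
  induction n with
  | zero =>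
    rintro S ⟨φ⟩
    obtain ⟨f, g, hf, hg, hfg⟩ := h
    refine ⟨E, A, hE, ⟨f, φ.symm.toLinearMap ∘ₗ g, hf, φ.symm.surjective.comp hg, ?_⟩,
      ⟨LinearEquiv.refl R A⟩⟩
    rw [hfg, LinearEquiv.ker_comp]
  | succ n ih =>
    rintro S ⟨T, F, hT, hF, hST⟩
    obtain ⟨G', B, hG', hB, hBA⟩ := ih T hT
    obtain ⟨G, D, H, hG, hD, hH, hDH⟩ := syz_one R S F T G' B hF hG' hST hB
    exact ⟨G, D, hG, hD, B, H, hBA, hH, hDH⟩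

theorem redStep_syz (R : Type u) [CommRing R] [IsNoetherianRing R]
    (N F K : ModuleCat.{u} R) (hK : RedStep R N K) (π : F →ₗ[R] N) (hF : IsFinFree R F)
    (hπ : Function.Surjective π) :
    ∃ (E : ModuleCat.{u} R) (ρ : E →ₗ[R] K), IsFinFree R E ∧ Function.Surjective ρ ∧
      RedStep R (ModuleCat.of R (LinearMap.ker π)) (ModuleCat.of R (LinearMap.ker ρ)) := by
  obtain ⟨a, b, n, ha, hb, hn, S, hS, f, g, hf, hg, hfg⟩ := hK
  obtain ⟨_, _⟩ := hF
  have hE : IsFinFree R (MPow R F b) := by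
    constructor
    · change Module.Finite R (Fin b → F); infer_instance
    · change Module.Free R (Fin b → F); infer_instance
  have hses : SES R (MPow R (ModuleCat.of R (LinearMap.ker π)) b) (MPow R F b)
      (MPow R N b) := by
    refine ⟨(LinearMap.ker π).subtype.compLeft (Fin b), π.compLeft (Fin b), ?_, ?_, ?_⟩
    · intro u v h
      funext j
      exact Subtype.ext (congrFun h j)
    · intro v
      choose u hu using fun j => hπ (v j)
      exact ⟨u, funext hu⟩
    · ext v
      constructor
      · rintro ⟨u, rfl⟩
        exact funext fun j => (u j).2
      · intro h
        exact ⟨fun j => ⟨v j, congrFun h j⟩, rfl⟩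
  obtain ⟨G, B, ⟨_, _⟩, ⟨i, q, hi, hq, hiq⟩, hB⟩ := syz_comparison R _ _ _ hE hses n S hS
  obtain ⟨l, hl⟩ := Module.projective_lifting_property g q hg
  have hl' : ∀ x, g (l x) = q x := fun x => LinearMap.congr_fun hl x
  have hgf : ∀ x, g (f x) = 0 := fun x => by
    have : f x ∈ LinearMap.ker g := hfg ▸ LinearMap.mem_range_self f x
    exact this
  have hgf' : ∀ x, g x = 0 → ∃ y, f y = x := fun x hx => by
    have : x ∈ LinearMap.range f := hfg ▸ hx
    exact this
  have hqi : ∀ x, q (i x) = 0 := fun x => by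
    have : i x ∈ LinearMap.ker q := hiq ▸ LinearMap.mem_range_self i x
    exact this
  have hqi' : ∀ x, q x = 0 → ∃ y, i y = x := fun x hx => by
    have : x ∈ LinearMap.range i := hiq ▸ hx
    exact this
  let p : (Fin a → F) →ₗ[R] (MPow R N a) := π.compLeft (Fin a)
  have hp : Function.Surjective p := by
    intro v
    choose u hu using fun j => hπ (v j)
    exact ⟨u, funext hu⟩
  let ρ : ((Fin a → F) × G) →ₗ[R] K := LinearMap.coprod (f ∘ₗ p) l
  have hρ : ∀ u v, ρ (u, v) = f (p u) + l v := fun u v => by simp [ρ]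
  have hρg : ∀ u v, g (ρ (u, v)) = q v := fun u v => by simp [hρ, hgf, hl']
  obtain ⟨τ, hτ⟩ : ∃ τ : LinearMap.ker ρ →ₗ[R] B, ∀ x, i (τ x) = x.1.2 :=
    ⟨LinearMap.codRestrictOfInjective
      (LinearMap.snd R _ _ ∘ₗ (LinearMap.ker ρ).subtype) i hi (fun x => by
      obtain ⟨⟨u, v⟩, hx⟩ := x
      obtain ⟨z, hz⟩ := hqi' v (by rw [← hρg u v, LinearMap.mem_ker.mp hx, map_zero])
      exact ⟨z, hz⟩), fun x => by simp⟩
  refine ⟨ModuleCat.of R ((Fin a → F) × G), ρ, ⟨?_, ?_⟩, ?_,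
    a, b, n, ha, hb, hn, B, hB, ?_, τ, ?_, ?_, ?_⟩
  · change Module.Finite R ((Fin a → F) × G); infer_instance
  · change Module.Free R ((Fin a → F) × G); infer_instance
  · intro k
    obtain ⟨v, hv⟩ := hq (g k)
    obtain ⟨w, hw⟩ := hgf' (k - l v) (by rw [map_sub, hl', hv, sub_self])
    obtain ⟨u, rfl⟩ := hp w
    exact ⟨(u, v), by rw [hρ, hw]; simp⟩
  · exact LinearMap.codRestrict (LinearMap.ker ρ)
      (LinearMap.inl R (Fin a → F) G ∘ₗ (LinearMap.ker π).subtype.compLeft (Fin a))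
      (fun u => by
        change ρ (fun j => (u j).1, 0) = 0
        have : p (fun j => (u j).1) = 0 := funext fun j => (u j).2
        rw [hρ, this]; simp)
  · intro u v h
    funext j
    exact Subtype.ext (congrFun (congrArg (fun z => z.1.1) h) j)
  · intro y
    obtain ⟨w, hw⟩ := hgf' (l (i y)) (by rw [hl', hqi])
    obtain ⟨u, rfl⟩ := hp w
    refine ⟨⟨(-u, i y), ?_⟩, hi ?_⟩
    · rw [LinearMap.mem_ker, hρ, ← hw]; simp
    · rw [hτ]
  · ext ⟨⟨u, v⟩, hx⟩
    constructor
    · rintro ⟨w, h⟩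
      have h2 : 0 = v := congrArg (fun z => z.1.2) h
      refine hi ?_
      rw [hτ, map_zero]
      exact h2.symm
    · intro h
      have h1 := hτ ⟨(u, v), hx⟩
      have h' : τ ⟨(u, v), hx⟩ = 0 := h
      rw [h', map_zero] at h1
      have h2 : 0 = v := h1
      subst h2
      have h3 : f (p u) = 0 := by
        have := LinearMap.mem_ker.mp hx
        rw [hρ] at this
        simpa using this
      have h4 : p u = 0 := hf (by rw [h3, map_zero])
      exact ⟨fun j => ⟨u j, congrFun h4 j⟩, rfl⟩

theorem hasRedSeqTo_syzygy_aux (R : Type u) [CommRing R] [IsNoetherianRing R]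
    (P : ModuleCat.{u} R → Prop)
    (h2 : ∀ (X F : ModuleCat.{u} R) (π : F →ₗ[R] X), Module.Finite R X → IsFinFree R F →
      Function.Surjective π → (P X ↔ P (ModuleCat.of R (LinearMap.ker π)))) (r : ℕ) :
    ∀ (K : Fin (r + 1) → ModuleCat.{u} R), IsReducingSeq R K → P (K (Fin.last r)) →
    ∀ (F : ModuleCat.{u} R) (π : F →ₗ[R] K 0), IsFinFree R F → Function.Surjective π →
      HasRedSeqTo R P (ModuleCat.of R (LinearMap.ker π)) := by
  induction r with
  | zero =>
    intro K hK hP F π hF hπ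
    have := hF.1
    refine ⟨0, fun _ => ModuleCat.of R (LinearMap.ker π), rfl, ⟨fun _ => ?_, Fin.elim0,
      Fin.elim0, Fin.elim0, fun i => i.elim0, fun i => i.elim0, fun i => i.elim0,
      fun i => i.elim0⟩, ?_⟩
    · change Module.Finite R (LinearMap.ker π); infer_instance
    · exact (h2 _ F π (hK.1 0) hF hπ).mp hP
  | succ r ih =>
    intro K hK hP F π hF hπ
    obtain ⟨hfin, a, b, n, ha, hb, hn, hS⟩ := hK
    have hstep : RedStep R (K 0) (K 1) := ⟨a 0, b 0, n 0, ha 0, hb 0, hn 0, hS 0⟩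
    obtain ⟨E, ρ, hE, hρ, hs⟩ := redStep_syz R _ F _ hstep π hF hπ
    refine hasRedSeqTo_cons R P _ _ ?_ hs (ih (fun i => K i.succ) ⟨fun i => hfin _,
      fun i => a i.succ, fun i => b i.succ, fun i => n i.succ, fun i => ha _, fun i => hb _,
      fun i => hn _, fun i => hS i.succ⟩ hP E ρ hE hρ)
    have := hF.1
    change Module.Finite R (LinearMap.ker π); infer_instance

theorem hasRedSeqTo_syzygy
    (R : Type u) [CommRing R] [IsNoetherianRing R] [IsLocalRing R]
    (𝒞 : ModuleCat.{u} R → Prop)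
    (h1 : 𝒞 (ModuleCat.of R R))
    (h2 : ∀ (X F : ModuleCat.{u} R) (π : F →ₗ[R] X), Module.Finite R X → IsFinFree R F →
      Function.Surjective π → (𝒞 X ↔ 𝒞 (ModuleCat.of R (LinearMap.ker π))))
    (h3 : ∀ X : ModuleCat.{u} R, Module.Finite R X →
      (𝒞 X ↔ 𝒞 (ModuleCat.of R (↥X × R))))
    (N : ModuleCat.{u} R) (hN : Module.Finite R N)
    (hred : HasRedSeqTo R 𝒞 N) :
    ∀ (F : ModuleCat.{u} R) (π : F →ₗ[R] N), IsFinFree R F → Function.Surjective π →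
      HasRedSeqTo R 𝒞 (ModuleCat.of R (LinearMap.ker π)) := by
  obtain ⟨r, K, rfl, hK, hP⟩ := hred
  exact hasRedSeqTo_syzygy_aux R 𝒞 h2 r K hK hP
end

section
/- Let R be a commutative Noetherian local ring and let 𝒞 be a class of finitely generated R-modules satisfying: (1) R ∈ 𝒞; (2) for every finitely generated module X and every surjective R-linear map π : F → X with F finitely generated free, X ∈ 𝒞 if and only if ker π ∈ 𝒞; (3) for every finitely generated module X, X ∈ 𝒞 if and only if X ⊕ R ∈ 𝒞. Let N be a finitely generated module and let M be the kernel of a surjective R-linear map F → N with F finitely generated free. If Ext^i_R(M,R) = 0 for all i ≥ 1 and M admits a reducing sequence whose last module lies in 𝒞, then N admits a reducing sequence whose last module lies in 𝒞. -/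
open CategoryTheory

universe u

variable (R : Type u) [CommRing R]

/-- All the positive `Ext` groups into `R` vanish (for the derived category `Ext`). -/
def EV (M : ModuleCat.{u} R) : Prop :=
  ∀ i : ℕ, 1 ≤ i → ∀ x : Abelian.Ext M (ModuleCat.of R R) i, x = 0

lemma EV_of_extVanishes (M : ModuleCat.{u} R)
    (h : ∀ i : ℕ, 1 ≤ i → ExtVanishes R M (ModuleCat.of R R) i) : EV R M := by
  intro i hi x
  let P := ProjectiveResolution.of M
  obtain ⟨f, hf, rfl⟩ := P.extMk_surjective x (i + 1) rfl
  obtain ⟨p, rfl⟩ : ∃ p, i = p + 1 := ⟨i - 1, by omega⟩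
  rw [P.extMk_eq_zero_iff f _ rfl hf p rfl]
  have h0 := h (p + 1) hi
  have hz : Limits.IsZero ((P.complex.linearYonedaObj R (ModuleCat.of R R)).homology (p + 1)) := by
    refine Limits.IsZero.of_iso ?_ (P.isoExt (p + 1) (ModuleCat.of R R)).symm
    unfold ExtVanishes at h0
    exact ModuleCat.isZero_of_subsingleton _
  rw [← HomologicalComplex.exactAt_iff_isZero_homology,
    HomologicalComplex.exactAt_iff' _ p (p + 1) (p + 2) (by simp) (by simp),
    ShortComplex.moduleCat_exact_iff] at hz
  obtain ⟨g, hg⟩ := hz f hf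
  exact ⟨g, hg⟩

variable {R}

/-- the short complex attached to an `SES`. -/
lemma ses_shortExact {A B C : ModuleCat.{u} R} (f : A →ₗ[R] B) (g : B →ₗ[R] C)
    (hf : Function.Injective f) (hg : Function.Surjective g)
    (hfg : LinearMap.range f = LinearMap.ker g) :
    ∃ w : ModuleCat.ofHom f ≫ ModuleCat.ofHom g = 0,
      (ShortComplex.mk (ModuleCat.ofHom f) (ModuleCat.ofHom g) w).ShortExact := by
  have w : ModuleCat.ofHom f ≫ ModuleCat.ofHom g = 0 := by
    ext x
    have : f x ∈ LinearMap.ker g := hfg ▸ LinearMap.mem_range_self f x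
    simpa using this
  refine ⟨w, ?_⟩
  have h1 : Mono (ModuleCat.ofHom f) := (ModuleCat.mono_iff_injective _).2 hf
  have h2 : Epi (ModuleCat.ofHom g) := (ModuleCat.epi_iff_surjective _).2 hg
  refine { exact := ?_, mono_f := h1, epi_g := h2 }
  rw [ShortComplex.moduleCat_exact_iff]
  intro x hx
  have : x ∈ LinearMap.range f := hfg ▸ (LinearMap.mem_ker.2 hx)
  exact this

lemma EV_mid {A B C : ModuleCat.{u} R} (h : SES R A B C) (hA : EV R A) (hC : EV R C) :
    EV R B := by
  obtain ⟨f, g, hf, hg, hfg⟩ := h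
  obtain ⟨w, hS⟩ := ses_shortExact f g hf hg hfg
  intro i hi x
  obtain ⟨y, hy⟩ := Abelian.Ext.contravariant_sequence_exact₂ hS _ x (hA i hi _)
  rw [← hy, hC i hi y, Abelian.Ext.comp_zero]

lemma EV_proj (F : ModuleCat.{u} R) [Module.Projective R F] : EV R F := by
  intro i hi x
  obtain ⟨p, rfl⟩ : ∃ p, i = p + 1 := ⟨i - 1, by omega⟩
  have : Projective F := (IsProjective.iff_projective F).1 inferInstance
  exact x.eq_zero_of_projective

lemma EV_left {A F C : ModuleCat.{u} R} (h : SES R A F C) (hF : IsFinFree R F)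
    (hC : EV R C) : EV R A := by
  obtain ⟨f, g, hf, hg, hfg⟩ := h
  obtain ⟨w, hS⟩ := ses_shortExact f g hf hg hfg
  have := hF.2
  intro i hi x
  obtain ⟨y, hy⟩ := Abelian.Ext.contravariant_sequence_exact₁ hS _ x rfl (hC _ (by omega) _)
  rw [← hy, EV_proj F i hi y, Abelian.Ext.comp_zero]

lemma ses_iso_left {A A' B C : ModuleCat.{u} R} (e : A' ≃ₗ[R] A) (h : SES R A B C) :
    SES R A' B C := by
  obtain ⟨f, g, hf, hg, hfg⟩ := h
  refine ⟨f ∘ₗ e.toLinearMap, g, hf.comp e.injective, hg, ?_⟩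
  rw [LinearMap.range_comp_of_range_eq_top _ (LinearEquiv.range e), hfg]

lemma EV_iso {A B : ModuleCat.{u} R} (e : A ≃ₗ[R] B) (hB : EV R B) : EV R A := by
  intro i hi x
  let e' : A ≅ B := e.toModuleIso
  have : x = (Abelian.Ext.mk₀ e'.hom).comp
      ((Abelian.Ext.mk₀ e'.inv).comp x (zero_add i)) (zero_add i) := by
    rw [Abelian.Ext.mk₀_comp_mk₀_assoc]
    simp
  have h0 := hB i hi ((Abelian.Ext.mk₀ e'.inv).comp x (zero_add i))
  rw [this, h0, Abelian.Ext.comp_zero]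

lemma ses_single (M : Type u) [AddCommGroup M] [Module R M] (a : ℕ) :
    LinearMap.range (LinearMap.single R (fun _ : Fin (a + 1) => M) 0) =
      LinearMap.ker (LinearMap.funLeft R M (Fin.succ : Fin a → Fin (a + 1))) := by
  ext x
  constructor
  · rintro ⟨y, rfl⟩
    refine LinearMap.mem_ker.2 (funext fun i => ?_)
    simp [LinearMap.funLeft_apply]
  · intro hx
    refine ⟨x 0, funext fun i => ?_⟩
    refine Fin.cases ?_ (fun j => ?_) i
    · simp
    · have := congrFun (LinearMap.mem_ker.1 hx) j
      simp only [LinearMap.funLeft_apply, Pi.zero_apply] at this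
      simp [this]

lemma single_inj (M : Type u) [AddCommGroup M] [Module R M] (a : ℕ) :
    Function.Injective (LinearMap.single R (fun _ : Fin (a + 1) => M) 0) := by
  intro x y hxy
  simpa using congrFun hxy 0

lemma EV_pow {M : ModuleCat.{u} R} (h : EV R M) (a : ℕ) : EV R (MPow R M a) := by
  induction a with
  | zero =>
    have : Subsingleton (MPow R M 0) := inferInstanceAs (Subsingleton (Fin 0 → M))
    have : Module.Projective R (MPow R M 0) := inferInstance
    exact EV_proj _
  | succ a ih =>
    refine EV_mid ⟨LinearMap.single R (fun _ : Fin (a + 1) => (M : Type u)) 0,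
      LinearMap.funLeft R M Fin.succ, ?_, ?_, ?_⟩ h ih
    · exact single_inj M a
    · exact LinearMap.funLeft_surjective_of_injective _ _ _ (Fin.succ_injective a)
    · exact ses_single M a

lemma EV_syz {n : ℕ} {S K : ModuleCat.{u} R} (h : IsSyzygy R n S K) (hK : EV R K) :
    EV R S := by
  induction n generalizing S with
  | zero => exact EV_iso h.some hK
  | succ n ih =>
    obtain ⟨T, F, hT, hF, hs⟩ := h
    exact EV_left hs hF (ih hT)

lemma syz_shift {n : ℕ} {T X G Y : ModuleCat.{u} R} (h : IsSyzygy R n T X)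
    (hG : IsFinFree R G) (hs : SES R X G Y) : IsSyzygy R (n + 1) T Y := by
  induction n generalizing T with
  | zero => exact ⟨Y, G, ⟨LinearEquiv.refl R Y⟩, hG, ses_iso_left h.some hs⟩
  | succ n ih =>
    obtain ⟨T', F, hT, hF, hs'⟩ := h
    exact ⟨T', F, ih hT, hF, hs'⟩

lemma finFree_pow {G : ModuleCat.{u} R} (hG : IsFinFree R G) (a : ℕ) :
    IsFinFree R (MPow R G a) := by
  obtain ⟨h1, h2⟩ := hG
  exact ⟨inferInstanceAs (Module.Finite R (Fin a → G)),
    inferInstanceAs (Module.Free R (Fin a → G))⟩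

lemma ses_pow {A B C : ModuleCat.{u} R} (h : SES R A B C) (a : ℕ) :
    SES R (MPow R A a) (MPow R B a) (MPow R C a) := by
  obtain ⟨f, g, hf, hg, hfg⟩ := h
  refine ⟨f.compLeft (Fin a), g.compLeft (Fin a), ?_, ?_, ?_⟩
  · intro x y hxy
    exact funext fun i => hf (congrFun hxy i)
  · intro y
    choose s hs using hg
    exact ⟨fun i => s ((y : Fin a → C) i), funext fun i => hs _⟩
  · ext (x : Fin a → B)
    constructor
    · rintro ⟨y, rfl⟩
      refine LinearMap.mem_ker.2 (funext fun i => ?_)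
      have : f ((y : Fin a → A) i) ∈ LinearMap.ker g := hfg ▸ LinearMap.mem_range_self f _
      exact this
    · intro hx
      have : ∀ i, ∃ y, f y = x i := fun i => by
        have : x i ∈ LinearMap.range f := hfg ▸ LinearMap.mem_ker.2 (congrFun hx i)
        exact this
      choose y hy using this
      exact ⟨y, funext hy⟩

lemma extend_one {A B S : ModuleCat.{u} R} (f : A →ₗ[R] B) (g : B →ₗ[R] S)
    (hf : Function.Injective f) (hg : Function.Surjective g)
    (hfg : LinearMap.range f = LinearMap.ker g) (hS : EV R S) (φ : A →ₗ[R] R) :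
    ∃ ψ : B →ₗ[R] R, ∀ x, ψ (f x) = φ x := by
  obtain ⟨w, hE⟩ := ses_shortExact f g hf hg hfg
  let φ' : A ⟶ ModuleCat.of R R := ModuleCat.ofHom φ
  obtain ⟨y, hy⟩ := Abelian.Ext.contravariant_sequence_exact₁ hE _
    (Abelian.Ext.mk₀ φ') rfl (hS _ (by omega) _)
  obtain ⟨ψ, rfl⟩ := (Abelian.Ext.mk₀_bijective _ _).2 y
  rw [Abelian.Ext.mk₀_comp_mk₀] at hy
  have := (Abelian.Ext.mk₀_bijective _ _).1 hy
  exact ⟨ψ.hom, fun x => congrArg (fun t : A ⟶ ModuleCat.of R R => t.hom x) this⟩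

lemma extend_free {A B S G : ModuleCat.{u} R} (f : A →ₗ[R] B) (g : B →ₗ[R] S)
    (hf : Function.Injective f) (hg : Function.Surjective g)
    (hfg : LinearMap.range f = LinearMap.ker g) (hS : EV R S) (hG : IsFinFree R G)
    (φ : A →ₗ[R] G) : ∃ ψ : B →ₗ[R] G, ∀ x, ψ (f x) = φ x := by
  obtain ⟨h1, h2⟩ := hG
  let b := Module.Free.chooseBasis R G
  choose ψ hψ using fun i => extend_one f g hf hg hfg hS (b.coord i ∘ₗ φ)
  refine ⟨b.equivFun.symm.toLinearMap ∘ₗ LinearMap.pi ψ, fun x => ?_⟩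
  apply b.equivFun.injective
  ext i
  simp [hψ]

lemma horseshoe {A B S G L F T : ModuleCat.{u} R} (hAB : SES R A B S) (hA : SES R A G L)
    (hSF : SES R S F T) (hS : EV R S) (hG : IsFinFree R G) (hF : IsFinFree R F) :
    ∃ (L' E : ModuleCat.{u} R), Module.Finite R L' ∧ IsFinFree R E ∧ SES R B E L' ∧
      SES R L L' T := by
  obtain ⟨f, g, hf, hg, hfg⟩ := hAB
  obtain ⟨i, p, hi, hp, hip⟩ := hA
  obtain ⟨j, q, hj, hq, hjq⟩ := hSF
  obtain ⟨φ, hφ⟩ := extend_free f g hf hg hfg hS hG i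
  obtain ⟨hG1, hG2⟩ := hG
  obtain ⟨hF1, hF2⟩ := hF
  have hgf : ∀ x, g (f x) = 0 := fun x => by
    have : f x ∈ LinearMap.ker g := hfg ▸ LinearMap.mem_range_self f _
    exact this
  have hpi : ∀ x, p (i x) = 0 := fun x => by
    have : i x ∈ LinearMap.ker p := hip ▸ LinearMap.mem_range_self i _
    exact this
  have hqj : ∀ x, q (j x) = 0 := fun x => by
    have : j x ∈ LinearMap.ker q := hjq ▸ LinearMap.mem_range_self j _
    exact this
  have hg0 : ∀ x, g x = 0 → ∃ y, f y = x := fun x hx => by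
    have : x ∈ LinearMap.range f := hfg ▸ LinearMap.mem_ker.2 hx
    exact this
  have hp0 : ∀ x, p x = 0 → ∃ y, i y = x := fun x hx => by
    have : x ∈ LinearMap.range i := hip ▸ LinearMap.mem_ker.2 hx
    exact this
  have hq0 : ∀ x, q x = 0 → ∃ y, j y = x := fun x hx => by
    have : x ∈ LinearMap.range j := hjq ▸ LinearMap.mem_ker.2 hx
    exact this
  let u : B →ₗ[R] G × F := φ.prod (j ∘ₗ g)
  let W : Submodule R (G × F) := LinearMap.range u
  let α0 : (G ⧸ LinearMap.ker p) →ₗ[R] (G × F) ⧸ W :=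
    (LinearMap.ker p).liftQ (W.mkQ ∘ₗ LinearMap.inl R G F) (by
      intro x hx
      obtain ⟨y, rfl⟩ := hp0 x hx
      rw [LinearMap.mem_ker]
      refine (Submodule.Quotient.mk_eq_zero W).2 ⟨f y, ?_⟩
      simp [u, hφ, hgf])
  let e := p.quotKerEquivOfSurjective hp
  let α : L →ₗ[R] (G × F) ⧸ W := α0 ∘ₗ e.symm.toLinearMap
  have hα : ∀ x, α (p x) = W.mkQ (x, 0) := fun x => by
    have : e.symm (p x) = (LinearMap.ker p).mkQ x := by
      rw [LinearEquiv.symm_apply_eq]; rfl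
    simp only [α, LinearMap.comp_apply, LinearEquiv.coe_coe, this]
    rfl
  let β : ((G × F) ⧸ W) →ₗ[R] T := W.liftQ (q ∘ₗ LinearMap.snd R G F) (by
    rintro _ ⟨y, rfl⟩
    simp [u, hqj])
  have hβ : ∀ x, β (W.mkQ x) = q x.2 := fun x => rfl
  refine ⟨ModuleCat.of R ((G × F) ⧸ W), ModuleCat.of R (G × F),
    inferInstanceAs (Module.Finite R ((G × F) ⧸ W)),
    ⟨inferInstanceAs (Module.Finite R (G × F)), inferInstanceAs (Module.Free R (G × F))⟩,
    ⟨u, W.mkQ, ?_, W.mkQ_surjective, (W.ker_mkQ).symm⟩, ⟨α, β, ?_, ?_, ?_⟩⟩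
  · rw [injective_iff_map_eq_zero]
    intro x hx
    have h1 : φ x = 0 := congrArg Prod.fst hx
    have h2 : j (g x) = 0 := congrArg Prod.snd hx
    obtain ⟨y, rfl⟩ := hg0 x ((injective_iff_map_eq_zero j).1 hj _ h2)
    rw [hφ] at h1
    rw [(injective_iff_map_eq_zero i).1 hi _ h1, map_zero]
  · rw [injective_iff_map_eq_zero]
    intro x hx
    obtain ⟨x, rfl⟩ := hp x
    rw [hα] at hx
    obtain ⟨b, hb⟩ := (Submodule.Quotient.mk_eq_zero W).1 hx
    have h1 : φ b = x := congrArg Prod.fst hb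
    have h2 : j (g b) = 0 := congrArg Prod.snd hb
    obtain ⟨y, rfl⟩ := hg0 b ((injective_iff_map_eq_zero j).1 hj _ h2)
    rw [← h1, hφ, hpi]
  · intro t
    obtain ⟨y, rfl⟩ := hq t
    exact ⟨W.mkQ (0, y), hβ _⟩
  · ext z
    constructor
    · rintro ⟨x, rfl⟩
      obtain ⟨x, rfl⟩ := hp x
      rw [LinearMap.mem_ker, hα, hβ, map_zero]
    · intro hz
      obtain ⟨⟨x, y⟩, rfl⟩ := W.mkQ_surjective z
      rw [LinearMap.mem_ker, hβ] at hz
      obtain ⟨s, rfl⟩ := hq0 y hz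
      obtain ⟨b, rfl⟩ := hg s
      refine ⟨p (x - φ b), ?_⟩
      rw [hα]
      refine (Submodule.Quotient.eq W).2 ⟨-b, ?_⟩
      simp [u]

lemma red_cons {P : ModuleCat.{u} R → Prop} {M M' : ModuleCat.{u} R} (hM : Module.Finite R M)
    {a b n : ℕ} (ha : 0 < a) (hb : 0 < b) (hn : 0 < n) {S : ModuleCat.{u} R}
    (hS : IsSyzygy R n S (MPow R M b)) (hs : SES R (MPow R M a) M' S)
    (h : HasRedSeqTo R P M') : HasRedSeqTo R P M := by
  obtain ⟨r, K, rfl, ⟨hfin, a', b', n', ha', hb', hn', hK⟩, hP⟩ := h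
  refine ⟨r + 1, Fin.cons M K, rfl, ⟨?_, Fin.cons a a', Fin.cons b b', Fin.cons n n',
    ?_, ?_, ?_, ?_⟩, ?_⟩
  · exact fun i => Fin.cases hM hfin i
  · exact fun i => Fin.cases ha ha' i
  · exact fun i => Fin.cases hb hb' i
  · exact fun i => Fin.cases hn hn' i
  · exact fun i => Fin.cases ⟨S, hS, hs⟩ hK i
  · exact hP

lemma red_main {P : ModuleCat.{u} R → Prop}
    (hP : ∀ X G Y : ModuleCat.{u} R, Module.Finite R X → Module.Finite R Y → IsFinFree R G →
      SES R X G Y → P X → P Y)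
    (r : ℕ) : ∀ (K : Fin (r + 1) → ModuleCat.{u} R), IsReducingSeq R K → P (K (Fin.last r)) →
      EV R (K 0) → ∀ N G : ModuleCat.{u} R, Module.Finite R N → IsFinFree R G →
      SES R (K 0) G N → HasRedSeqTo R P N := by
  induction r with
  | zero =>
    intro K hK hPK hE N G hN hG hs
    refine ⟨0, fun _ => N, rfl, ⟨fun _ => hN, Fin.elim0, Fin.elim0, Fin.elim0, fun i => i.elim0,
      fun i => i.elim0, fun i => i.elim0, fun i => i.elim0⟩, ?_⟩
    exact hP _ G N (hK.1 0) hN hG hs hPK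
  | succ r ih =>
    intro K hK hPK hE N G hN hG hs
    obtain ⟨hfin, a, b, n, ha, hb, hn, hK⟩ := hK
    obtain ⟨S, hS, hs0⟩ := hK 0
    have hES : EV R S := EV_syz hS (EV_pow hE _)
    have hE1 : EV R (K 1) := EV_mid hs0 (EV_pow hE _) hES
    obtain ⟨m, hm⟩ : ∃ m, n 0 = m + 1 := ⟨n 0 - 1, by have := hn 0; omega⟩
    rw [hm] at hS
    obtain ⟨T, F, hT, hF, hSF⟩ := hS
    obtain ⟨L', E, hL', hEf, hKE, hLT⟩ := horseshoe hs0 (ses_pow hs _) hSF hES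
      (finFree_pow hG _) hF
    refine red_cons hN (ha 0) (hb 0) (Nat.succ_pos m)
      (syz_shift hT (finFree_pow hG _) (ses_pow hs _)) hLT ?_
    exact ih (fun i => K i.succ) ⟨fun i => hfin _, fun i => a i.succ, fun i => b i.succ,
      fun i => n i.succ, fun i => ha _, fun i => hb _, fun i => hn _, fun i => hK i.succ⟩
      hPK hE1 L' E hL' hEf hKE

theorem hasRedSeqTo_of_syzygy
    (R : Type u) [CommRing R] [IsNoetherianRing R] [IsLocalRing R]
    (𝒞 : ModuleCat.{u} R → Prop)
    (h1 : 𝒞 (ModuleCat.of R R))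
    (h2 : ∀ (X F : ModuleCat.{u} R) (π : F →ₗ[R] X), Module.Finite R X → IsFinFree R F →
      Function.Surjective π → (𝒞 X ↔ 𝒞 (ModuleCat.of R (LinearMap.ker π))))
    (h3 : ∀ X : ModuleCat.{u} R, Module.Finite R X →
      (𝒞 X ↔ 𝒞 (ModuleCat.of R (↥X × R))))
    (N F : ModuleCat.{u} R) (hN : Module.Finite R N) (hF : IsFinFree R F)
    (π : F →ₗ[R] N) (hπ : Function.Surjective π)
    (hext : ∀ i : ℕ, 1 ≤ i →
      ExtVanishes R (ModuleCat.of R (LinearMap.ker π)) (ModuleCat.of R R) i)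
    (hred : HasRedSeqTo R 𝒞 (ModuleCat.of R (LinearMap.ker π))) :
    HasRedSeqTo R 𝒞 N := by
  have hiso : ∀ X Y : ModuleCat.{u} R, Module.Finite R X → Module.Finite R Y →
      (X ≃ₗ[R] Y) → 𝒞 X → 𝒞 Y := by
    intro X Y hX hY e hCX
    obtain ⟨m, ρ, hρ⟩ := Module.Finite.exists_fin' R X
    let G : ModuleCat.{u} R := ModuleCat.of R (Fin m → R)
    have hG : IsFinFree R G :=
      ⟨inferInstanceAs (Module.Finite R (Fin m → R)), inferInstanceAs (Module.Free R (Fin m → R))⟩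
    have hk : LinearMap.ker (e.toLinearMap ∘ₗ ρ) = LinearMap.ker ρ :=
      LinearMap.ker_comp_of_ker_eq_bot _ e.ker
    have hX2 := (h2 X G ρ hX hG hρ).1 hCX
    refine (h2 Y G (e.toLinearMap ∘ₗ ρ) hY hG (e.surjective.comp hρ)).2 ?_
    rw [hk]
    exact hX2
  obtain ⟨r, K, hK0, hK, hlast⟩ := hred
  refine red_main ?_ r K hK hlast ?_ N F hN hF ?_
  · intro X G Y hX hY hG hs hCX
    obtain ⟨f, g, hf, hg, hfg⟩ := hs
    refine (h2 Y G g hY hG hg).2 ?_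
    let e : X ≃ₗ[R] LinearMap.ker g :=
      (LinearEquiv.ofInjective f hf).trans (LinearEquiv.ofEq _ _ hfg)
    exact hiso X (ModuleCat.of R (LinearMap.ker g)) hX (Module.Finite.equiv e) e hCX
  · rw [hK0]
    exact EV_of_extVanishes R _ hext
  · rw [hK0]
    exact ⟨(LinearMap.ker π).subtype, π, Subtype.val_injective, hπ, Submodule.range_subtype _⟩
end

section
/- Let k be a field, let R = k[x,y]/(x², xy, y²) (so R is a local ring whose maximal ideal m = (x,y) satisfies m² = 0), and let N = R/(x). Then N is not isomorphic to R^{⊕α} ⊕ k^{⊕β} for any integers α, β ≥ 0, and consequently N does not have finite reducing Gorenstein dimension. -/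
open CategoryTheory

universe u

variable (R : Type u) [CommRing R]

/-- The ring `k[x,y]/(x², xy, y²)`. -/
abbrev PaperRing (k : Type u) [Field k] : Type u :=
  MvPolynomial (Fin 2) k ⧸
    (Ideal.span {MvPolynomial.X 0 ^ 2, MvPolynomial.X 0 * MvPolynomial.X 1,
      MvPolynomial.X 1 ^ 2} : Ideal (MvPolynomial (Fin 2) k))

/-- The class of `x` in `k[x,y]/(x², xy, y²)`. -/
noncomputable abbrev PaperRing.x (k : Type u) [Field k] : PaperRing k :=
  Ideal.Quotient.mk _ (MvPolynomial.X 0)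

/-- The class of `y` in `k[x,y]/(x², xy, y²)`. -/
noncomputable abbrev PaperRing.y (k : Type u) [Field k] : PaperRing k :=
  Ideal.Quotient.mk _ (MvPolynomial.X 1)

/-- The module `N = R/(x)` over `R = k[x,y]/(x², xy, y²)`. -/
abbrev PaperModN (k : Type u) [Field k] : Type u :=
  PaperRing k ⧸ (Ideal.span {PaperRing.x k} : Ideal (PaperRing k))

/-- The residue field `k = R/(x,y)` of `R = k[x,y]/(x², xy, y²)`, as an `R`-module. -/
abbrev PaperResidue (k : Type u) [Field k] : Type u :=
  PaperRing k ⧸ (Ideal.span {PaperRing.x k, PaperRing.y k} : Ideal (PaperRing k))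

section GeneralLemmas

/-- Vanishing of `Ext^1(G, R)` gives the extension property for a projective presentation. -/
lemma ext_one_presentation (G : ModuleCat.{u} R)
    (hG : ExtVanishes R G (ModuleCat.of R R) 1) :
    ∃ (P0 P1 : ModuleCat.{u} R) (d : P1 →ₗ[R] P0) (e : P0 →ₗ[R] G),
      Module.Projective R P0 ∧ Function.Surjective e ∧ LinearMap.range d = LinearMap.ker e ∧
      ∀ ψ : P1 →ₗ[R] R, (∀ q, d q = 0 → ψ q = 0) → ∃ h : P0 →ₗ[R] R, ∀ q, ψ q = h (d q) := by
  let P : ProjectiveResolution G := (HasProjectiveResolution.out (Z := G)).some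
  refine ⟨P.complex.X 0, P.complex.X 1, (P.complex.d 1 0).hom, (P.π.f 0).hom, ?_, ?_, ?_, ?_⟩
  · rw [IsProjective.iff_projective]
    exact P.projective 0
  · have : Epi (P.π.f 0) := inferInstance
    exact (ModuleCat.epi_iff_surjective _).1 this
  · exact P.exact₀.moduleCat_range_eq_ker
  · intro ψ hψ
    have hz : Limits.IsZero ((P.complex.linearYonedaObj R (ModuleCat.of R R)).homology 1) := by
      refine Limits.IsZero.of_iso ?_ (P.isoExt (R := R) 1 (ModuleCat.of R R)).symm
      exact @ModuleCat.isZero_of_subsingleton _ _ _ hG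
    rw [← HomologicalComplex.exactAt_iff_isZero_homology,
      HomologicalComplex.exactAt_iff' _ 0 1 2 (by simp) (by simp),
      ShortComplex.moduleCat_exact_iff] at hz
    obtain ⟨h, hh⟩ := hz (ModuleCat.ofHom ψ : P.complex.X 1 ⟶ ModuleCat.of R R) (by
      change P.complex.d 2 1 ≫ ModuleCat.ofHom ψ = 0
      ext q
      apply hψ
      have := P.complex.d_comp_d 2 1 0
      exact congrArg (fun f => f.hom q) this)
    change P.complex.X 0 ⟶ ModuleCat.of R R at h
    change P.complex.d 1 0 ≫ h = ModuleCat.ofHom ψ at hh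
    exact ⟨h.hom, fun q => (congrArg (fun f => f.hom q) hh).symm⟩

variable {R}

/-- Elementwise form of freeness over a local ring with `m = (x,y)`, `m² = 0`. -/
def GoodMod (x y : R) (M : Type u) [AddCommGroup M] [Module R M] : Prop :=
  (∀ z : M, x • z = 0 → y • z = 0 → ∃ a b : M, z = x • a + y • b) ∧
  (∀ a b : M, x • a + y • b = 0 → (x • a = 0 ∧ y • a = 0) ∧ (x • b = 0 ∧ y • b = 0))

lemma GoodMod.of_equiv {x y : R} {M N : Type u} [AddCommGroup M] [Module R M]
    [AddCommGroup N] [Module R N] (e : M ≃ₗ[R] N) (h : GoodMod x y M) : GoodMod x y N := by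
  constructor
  · intro z h1 h2
    obtain ⟨a, b, hab⟩ := h.1 (e.symm z) (by rw [← map_smul, h1, map_zero])
      (by rw [← map_smul, h2, map_zero])
    exact ⟨e a, e b, by rw [← map_smul, ← map_smul, ← map_add, ← hab, e.apply_symm_apply]⟩
  · intro a b hab
    have := h.2 (e.symm a) (e.symm b) (by rw [← map_smul, ← map_smul, ← map_add, hab, map_zero])
    simpa only [← map_smul, LinearEquiv.map_eq_zero_iff] using this

lemma GoodMod.of_ses {x y : R} (hxx : x * x = 0) (hxy : x * y = 0) (hyy : y * y = 0)
    {S G M : Type u} [AddCommGroup S] [Module R S] [AddCommGroup G] [Module R G]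
    [AddCommGroup M] [Module R M] (f : S →ₗ[R] G) (g : G →ₗ[R] M)
    (hf : Function.Injective f) (hg : Function.Surjective g)
    (hfg : LinearMap.range f = LinearMap.ker g)
    (hS : GoodMod x y S) (hG : GoodMod x y G) : GoodMod x y M := by
  have hyx : y * x = 0 := by rw [mul_comm, hxy]
  have gf : ∀ s, g (f s) = 0 := fun s => by
    rw [← LinearMap.mem_ker, ← hfg]; exact ⟨s, rfl⟩
  have lift : ∀ w, g w = 0 → ∃ s, f s = w := fun w hw => by
    have : w ∈ LinearMap.range f := by rw [hfg]; exact hw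
    exact this
  have key : ∀ a b : G, g (x • a + y • b) = 0 →
      ∃ c d : S, x • (a - f c) + y • (b - f d) = 0 := by
    intro a b h
    obtain ⟨s, hs⟩ := lift _ h
    obtain ⟨c, d, hcd⟩ := hS.1 s
      (hf (by rw [map_smul, hs, map_zero, smul_add, smul_smul, smul_smul, hxx, hxy]; simp))
      (hf (by rw [map_smul, hs, map_zero, smul_add, smul_smul, smul_smul, hyx, hyy]; simp))
    refine ⟨c, d, ?_⟩
    rw [hcd, map_add, map_smul, map_smul] at hs
    rw [smul_sub, smul_sub, sub_add_sub_comm, hs, sub_self]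
  constructor
  · intro z h1 h2
    obtain ⟨w, rfl⟩ := hg z
    obtain ⟨c, d, hcd⟩ := key w 0 (by simpa using h1)
    have h3 := (hG.2 _ _ hcd).1
    obtain ⟨a, b, hab⟩ := hG.1 _ h3.1 h3.2
    refine ⟨g a, g b, ?_⟩
    have := congrArg g hab
    simpa [gf] using this
  · intro a b hab
    obtain ⟨a, rfl⟩ := hg a
    obtain ⟨b, rfl⟩ := hg b
    obtain ⟨c, d, hcd⟩ := key a b (by simpa using hab)
    obtain ⟨⟨h1, h2⟩, h3, h4⟩ := hG.2 _ _ hcd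
    have h1 := congrArg g h1
    have h2 := congrArg g h2
    have h3 := congrArg g h3
    have h4 := congrArg g h4
    simp only [map_smul, map_sub, gf, sub_zero, map_zero] at h1 h2 h3 h4
    exact ⟨⟨h1, h2⟩, h3, h4⟩

lemma GoodMod.of_totallyReflexive {x y : R} {I : Ideal R} (hI : I = Ideal.span {x, y})
    (H1 : ∀ r ∈ I, x * r = 0 ∧ y * r = 0)
    (H2 : ∀ a b : R, x * a + y * b = 0 → a ∈ I ∧ b ∈ I)
    (H3 : I.IsMaximal)
    (θ : I →ₗ[R] R)
    (hθx : ∀ h, θ ⟨x, h⟩ = x) (hθy : ∀ h, θ ⟨y, h⟩ = 0)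
    (G : ModuleCat.{u} R) (hG : IsTotallyReflexive R G) : GoodMod x y G := by
  constructor
  · intro z hxz hyz
    by_contra hne
    obtain ⟨P0, P1, d, e, hP, he, hde, hext⟩ := ext_one_presentation R G (hG.2 1 le_rfl).1
    have hxI : x ∈ I := hI ▸ Ideal.subset_span (by simp)
    have hyI : y ∈ I := hI ▸ Ideal.subset_span (by simp)
    let _ : Field (R ⧸ I) := Ideal.Quotient.field I
    have hz : Submodule.Quotient.mk (p := (I • ⊤ : Submodule R G)) z ≠ 0 := by
      rw [Ne, Submodule.Quotient.mk_eq_zero]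
      intro hz
      apply hne
      refine Submodule.smul_induction_on hz ?_ ?_
      · intro r hr n _
        obtain ⟨s, t, rfl⟩ := Ideal.mem_span_pair.1 (hI ▸ hr)
        exact ⟨s • n, t • n, by rw [add_smul, smul_smul, smul_smul, mul_comm s, mul_comm t]⟩
      · rintro _ _ ⟨a, b, rfl⟩ ⟨a', b', rfl⟩
        exact ⟨a + a', b + b', by rw [smul_add, smul_add]; abel⟩
    obtain ⟨φ, hφ⟩ : ∃ φ : Module.Dual (R ⧸ I) (G ⧸ (I • ⊤ : Submodule R G)),
        φ (Submodule.Quotient.mk z) ≠ 0 := by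
      by_contra hcon
      push Not at hcon
      exact hz ((Module.forall_dual_apply_eq_zero_iff (R ⧸ I) _).1 hcon)
    let φ' : G →ₗ[R] R ⧸ I := (φ.restrictScalars R).comp (Submodule.mkQ _)
    obtain ⟨s, hs⟩ := Module.projective_lifting_property
      (Submodule.mkQ I : R →ₗ[R] R ⧸ I) (φ'.comp e) (Submodule.mkQ_surjective _)
    have hs' : ∀ p, (Submodule.Quotient.mk (s p) : R ⧸ I) = φ' (e p) :=
      fun p => congrArg (fun f => f p) hs
    have hsd : ∀ q, s (d q) ∈ I := by
      intro q
      rw [← Submodule.Quotient.mk_eq_zero, hs']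
      have : d q ∈ LinearMap.ker e := by rw [← hde]; exact ⟨q, rfl⟩
      rw [LinearMap.mem_ker.1 this, map_zero]
    obtain ⟨h, hh⟩ := hext (θ.comp ((s.comp d).codRestrict I hsd)) (by
      intro q hq
      have : (s.comp d).codRestrict I hsd q = 0 := by
        apply Subtype.ext; simp [hq]
      rw [LinearMap.comp_apply, this, map_zero])
    obtain ⟨p, hp⟩ := he z
    have hsp : s p ∉ I := by
      rw [← Submodule.Quotient.mk_eq_zero, hs', hp]
      exact hφ
    have main : ∀ r (hr : r ∈ I), r • z = 0 → r * h p = s p * θ ⟨r, hr⟩ := by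
      intro r hr hrz
      have : r • p ∈ LinearMap.range d := by
        rw [hde, LinearMap.mem_ker, map_smul, hp, hrz]
      obtain ⟨q, hq⟩ := this
      have h1 := hh q
      rw [hq, map_smul, smul_eq_mul] at h1
      rw [← h1, ← smul_eq_mul, ← map_smul]
      rw [LinearMap.comp_apply]
      congr 1
      apply Subtype.ext
      simp [hq, mul_comm]
    have m1 := main x hxI hxz
    have m2 := main y hyI hyz
    rw [hθx] at m1
    rw [hθy, mul_zero] at m2
    have hpI : h p ∈ I := (H2 0 (h p) (by rw [mul_zero, zero_add, m2])).2
    rw [(H1 _ hpI).1] at m1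
    exact hsp (H2 (s p) 0 (by rw [mul_zero, add_zero, mul_comm, ← m1])).1
  · intro a b hab
    have hinj := hG.1.1
    have hf : ∀ f : Module.Dual R G, f a ∈ I ∧ f b ∈ I := by
      intro f
      apply H2
      have := congrArg f hab
      simpa using this
    have van : ∀ w : G, (∀ f : Module.Dual R G, f w = 0) → w = 0 := by
      intro w hw
      apply hinj
      rw [map_zero]
      ext f
      exact hw f
    refine ⟨⟨?_, ?_⟩, ?_, ?_⟩ <;> apply van <;> intro f <;> rw [map_smul, smul_eq_mul]
    · exact (H1 _ (hf f).1).1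
    · exact (H1 _ (hf f).1).2
    · exact (H1 _ (hf f).2).1
    · exact (H1 _ (hf f).2).2

lemma GoodMod.of_resolvedBy {x y : R} (hxx : x * x = 0) (hxy : x * y = 0) (hyy : y * y = 0)
    (P : ModuleCat.{u} R → Prop) (hP : ∀ G, P G → GoodMod x y G) (m : ℕ) :
    ∀ M : ModuleCat.{u} R, ResolvedBy R P m M → GoodMod x y M := by
  induction m with
  | zero =>
    rintro M ⟨G, hG, ⟨e⟩⟩
    exact (hP G hG).of_equiv e
  | succ m ih =>
    rintro M ⟨G, S, hG, ⟨f, g, hf, hg, hfg⟩, hS⟩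
    exact GoodMod.of_ses hxx hxy hyy f g hf hg hfg (ih S hS) (hP G hG)

/-- `M` contains an element killed by `x` but not by `y`. -/
def BadElt (x y : R) (M : Type u) [AddCommGroup M] [Module R M] : Prop :=
  ∃ w : M, x • w = 0 ∧ y • w ≠ 0

lemma BadElt.not_good {x y : R} {M : Type u} [AddCommGroup M] [Module R M]
    (h : BadElt x y M) : ¬ GoodMod x y M := by
  obtain ⟨w, h1, h2⟩ := h
  intro hg
  exact h2 (hg.2 w 0 (by rw [h1, smul_zero, add_zero])).1.2

lemma BadElt.of_injective {x y : R} {M N : Type u} [AddCommGroup M] [Module R M]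
    [AddCommGroup N] [Module R N] (f : M →ₗ[R] N) (hf : Function.Injective f)
    (h : BadElt x y M) : BadElt x y N := by
  obtain ⟨w, h1, h2⟩ := h
  refine ⟨f w, by rw [← map_smul, h1, map_zero], ?_⟩
  rw [← map_smul]
  intro h
  exact h2 (hf (by rw [h, map_zero]))

lemma BadElt.of_reducingSeq {x y : R} {r : ℕ} (K : Fin (r + 1) → ModuleCat.{u} R)
    (hK : IsReducingSeq R K) (h0 : BadElt x y (K 0)) : BadElt x y (K (Fin.last r)) := by
  obtain ⟨_, a, b, n, ha, _, _, hs⟩ := hK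
  suffices ∀ i : Fin (r + 1), BadElt x y (K i) from this _
  intro i
  induction i using Fin.induction with
  | zero => exact h0
  | succ i ih =>
    obtain ⟨S, _, f, g, hf, _, _⟩ := hs i
    have h1 : BadElt x y (MPow R (K i.castSucc) (a i)) := by
      obtain ⟨w, h1, h2⟩ := ih
      refine ⟨(fun _ => w : Fin (a i) → K i.castSucc), ?_, ?_⟩
      · funext j
        exact h1
      · intro h
        exact h2 (congrFun h ⟨0, ha i⟩)
    exact h1.of_injective f hf

lemma not_finiteRedGdim_of_badElt {x y : R}
    (H1 : ∀ r ∈ Ideal.span {x, y}, x * r = 0 ∧ y * r = 0)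
    (H2 : ∀ a b : R, x * a + y * b = 0 → a ∈ Ideal.span {x, y} ∧ b ∈ Ideal.span {x, y})
    (H3 : (Ideal.span {x, y} : Ideal R).IsMaximal)
    (θ : (Ideal.span {x, y} : Ideal R) →ₗ[R] R)
    (hθx : ∀ h, θ ⟨x, h⟩ = x) (hθy : ∀ h, θ ⟨y, h⟩ = 0)
    (M : ModuleCat.{u} R) (hM : BadElt x y M) : ¬ FiniteRedGdim R M := by
  rintro ⟨r, K, hK0, hK, m, hm⟩
  have hxI : x ∈ Ideal.span {x, y} := Ideal.subset_span (by simp)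
  have hyI : y ∈ Ideal.span {x, y} := Ideal.subset_span (by simp)
  refine (BadElt.of_reducingSeq K hK (by rw [hK0]; exact hM)).not_good ?_
  exact GoodMod.of_resolvedBy (H1 _ hxI).1 (H1 _ hyI).1 (H1 _ hyI).2 _
    (GoodMod.of_totallyReflexive rfl H1 H2 H3 θ hθx hθy) m _ hm

end GeneralLemmas

section PaperRingLemmas

variable (k : Type u) [Field k]

/-- Comparison of the ring with the trivial square-zero extension of `k` by `k × k`. -/
noncomputable def paperCoeff : PaperRing k →+* TrivSqZeroExt k (k × k) :=
  Ideal.Quotient.lift _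
    (MvPolynomial.aeval (R := k) (S₁ := TrivSqZeroExt k (k × k))
      ![TrivSqZeroExt.inr (1, 0), TrivSqZeroExt.inr (0, 1)]).toRingHom (by
    intro a ha
    rw [← RingHom.mem_ker]
    refine (Ideal.span_le.2 ?_ : Ideal.span _ ≤ RingHom.ker _) ha
    rintro a (rfl | rfl | rfl) <;>
      simp [RingHom.mem_ker, pow_two, TrivSqZeroExt.inr_mul_inr])

lemma paperCoeff_x : paperCoeff k (PaperRing.x k) = TrivSqZeroExt.inr (1, 0) := by
  simp [paperCoeff]

lemma paperCoeff_y : paperCoeff k (PaperRing.y k) = TrivSqZeroExt.inr (0, 1) := by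
  simp [paperCoeff]

/-- The structure map `k → R`. -/
noncomputable def paperC : k →+* PaperRing k :=
  (Ideal.Quotient.mk _).comp MvPolynomial.C

lemma paperCoeff_C (c : k) : paperCoeff k (paperC k c) = TrivSqZeroExt.inl c := by
  simp [paperCoeff, paperC]
  rfl

lemma paper_xx : PaperRing.x k * PaperRing.x k = 0 := by
  rw [PaperRing.x, ← map_mul, Ideal.Quotient.eq_zero_iff_mem, ← pow_two]
  exact Ideal.subset_span (by simp)

lemma paper_xy : PaperRing.x k * PaperRing.y k = 0 := by
  rw [PaperRing.x, ← map_mul, Ideal.Quotient.eq_zero_iff_mem]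
  exact Ideal.subset_span (by simp)

lemma paper_yy : PaperRing.y k * PaperRing.y k = 0 := by
  rw [PaperRing.y, ← map_mul, Ideal.Quotient.eq_zero_iff_mem, ← pow_two]
  exact Ideal.subset_span (by simp)

lemma paper_exists (r : PaperRing k) :
    ∃ c a b : k, r = paperC k c + paperC k a * PaperRing.x k + paperC k b * PaperRing.y k := by
  obtain ⟨p, rfl⟩ := Ideal.Quotient.mk_surjective r
  have hxx := paper_xx k
  have hxy := paper_xy k
  have hyy := paper_yy k
  induction p using MvPolynomial.induction_on with
  | C c => exact ⟨c, 0, 0, by rw [map_zero, zero_mul, zero_mul, add_zero, add_zero]; rfl⟩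
  | add p q hp hq =>
    obtain ⟨c, a, b, h⟩ := hp
    obtain ⟨c', a', b', h'⟩ := hq
    refine ⟨c + c', a + a', b + b', ?_⟩
    rw [map_add, h, h', map_add, map_add, map_add]
    ring
  | mul_X p i hp =>
    obtain ⟨c, a, b, h⟩ := hp
    rw [map_mul, h]
    have hi : i = 0 ∨ i = 1 := by omega
    rcases hi with rfl | rfl
    · refine ⟨0, c, 0, ?_⟩
      change _ * PaperRing.x k = _
      rw [map_zero]
      linear_combination (paperC k a) * hxx + (paperC k b) * hxy
    · refine ⟨0, 0, c, ?_⟩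
      change _ * PaperRing.y k = _
      rw [map_zero]
      linear_combination (paperC k a) * hxy + (paperC k b) * hyy

lemma paperCoeff_eq (c a b : k) :
    paperCoeff k (paperC k c + paperC k a * PaperRing.x k + paperC k b * PaperRing.y k)
      = TrivSqZeroExt.inl c + TrivSqZeroExt.inr (a, b) := by
  rw [map_add, map_add, map_mul, map_mul, paperCoeff_x, paperCoeff_y, paperCoeff_C,
    paperCoeff_C, paperCoeff_C]
  ext <;> simp

/-- Every element is determined by its coefficients. -/
lemma paper_repr (r : PaperRing k) :
    r = paperC k (paperCoeff k r).fst + paperC k (paperCoeff k r).snd.1 * PaperRing.x k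
      + paperC k (paperCoeff k r).snd.2 * PaperRing.y k := by
  obtain ⟨c, a, b, h⟩ := paper_exists k r
  have h2 := paperCoeff_eq k c a b
  rw [← h] at h2
  rw [h2]
  simpa using h

lemma paper_mem_iff (r : PaperRing k) :
    r ∈ (Ideal.span {PaperRing.x k, PaperRing.y k} : Ideal (PaperRing k)) ↔
      (paperCoeff k r).fst = 0 := by
  rw [Ideal.mem_span_pair]
  constructor
  · rintro ⟨s, t, rfl⟩
    rw [map_add, map_mul, map_mul, paperCoeff_x, paperCoeff_y]
    simp
  · intro h
    refine ⟨paperC k (paperCoeff k r).snd.1, paperC k (paperCoeff k r).snd.2, ?_⟩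
    conv_rhs => rw [paper_repr k r, h, map_zero, zero_add]

lemma paper_mul_x (r : PaperRing k) :
    r * PaperRing.x k = paperC k (paperCoeff k r).fst * PaperRing.x k := by
  have hxx := paper_xx k
  have hxy := paper_xy k
  conv_lhs => rw [paper_repr k r]
  linear_combination paperC k (paperCoeff k r).snd.1 * hxx + paperC k (paperCoeff k r).snd.2 * hxy

lemma paper_mul_y (r : PaperRing k) :
    r * PaperRing.y k = paperC k (paperCoeff k r).fst * PaperRing.y k := by
  have hxy := paper_xy k
  have hyy := paper_yy k
  conv_lhs => rw [paper_repr k r]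
  linear_combination paperC k (paperCoeff k r).snd.1 * hxy + paperC k (paperCoeff k r).snd.2 * hyy

lemma paper_H1 (r : PaperRing k)
    (hr : r ∈ (Ideal.span {PaperRing.x k, PaperRing.y k} : Ideal (PaperRing k))) :
    PaperRing.x k * r = 0 ∧ PaperRing.y k * r = 0 := by
  rw [paper_mem_iff] at hr
  rw [mul_comm, paper_mul_x, mul_comm _ r, paper_mul_y, hr, map_zero, zero_mul, zero_mul]
  exact ⟨rfl, rfl⟩

lemma paper_H2 (a b : PaperRing k) (h : PaperRing.x k * a + PaperRing.y k * b = 0) :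
    a ∈ (Ideal.span {PaperRing.x k, PaperRing.y k} : Ideal (PaperRing k)) ∧
    b ∈ (Ideal.span {PaperRing.x k, PaperRing.y k} : Ideal (PaperRing k)) := by
  rw [paper_mem_iff, paper_mem_iff]
  have h2 := congrArg (paperCoeff k) h
  rw [map_add, map_mul, map_mul, paperCoeff_x, paperCoeff_y, map_zero] at h2
  have h3 := congrArg (fun t => t.snd.1) h2
  have h4 := congrArg (fun t => t.snd.2) h2
  simp at h3 h4
  exact ⟨h3, h4⟩

lemma paper_H3 :
    (Ideal.span {PaperRing.x k, PaperRing.y k} : Ideal (PaperRing k)).IsMaximal := by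
  let f : PaperRing k →+* k := (TrivSqZeroExt.fstHom k k (k × k)).toRingHom.comp (paperCoeff k)
  have hf : Function.Surjective f := by
    intro c
    refine ⟨paperC k c, ?_⟩
    change (paperCoeff k (paperC k c)).fst = c
    rw [paperCoeff_C, TrivSqZeroExt.fst_inl]
  have : (Ideal.span {PaperRing.x k, PaperRing.y k} : Ideal (PaperRing k)) = RingHom.ker f := by
    ext r
    rw [paper_mem_iff, RingHom.mem_ker]
    rfl
  rw [this]
  exact RingHom.ker_isMaximal_of_surjective f hf

/-- The endomorphism of `m` fixing `x` and killing `y`. -/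
noncomputable def paperTheta :
    (Ideal.span {PaperRing.x k, PaperRing.y k} : Ideal (PaperRing k)) →ₗ[PaperRing k]
      PaperRing k where
  toFun r := paperC k (paperCoeff k r.1).snd.1 * PaperRing.x k
  map_add' r s := by
    change paperC k (paperCoeff k (r.1 + s.1)).snd.1 * PaperRing.x k = _
    rw [map_add, TrivSqZeroExt.snd_add, Prod.fst_add, map_add, add_mul]
  map_smul' t r := by
    change paperC k (paperCoeff k (t * r.1)).snd.1 * PaperRing.x k =
      t * (paperC k (paperCoeff k r.1).snd.1 * PaperRing.x k)
    have hr := (paper_mem_iff k r.1).1 r.2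
    rw [mul_left_comm, paper_mul_x k t, map_mul, TrivSqZeroExt.snd_mul, hr]
    simp
    ring

lemma paper_badElt : BadElt (PaperRing.x k) (PaperRing.y k) (PaperModN k) := by
  refine ⟨Submodule.Quotient.mk 1, ?_, ?_⟩
  · rw [← Submodule.Quotient.mk_smul, Submodule.Quotient.mk_eq_zero, smul_eq_mul, mul_one]
    exact Ideal.subset_span rfl
  · rw [← Submodule.Quotient.mk_smul, Ne, Submodule.Quotient.mk_eq_zero, smul_eq_mul, mul_one]
    intro h
    obtain ⟨r, hr⟩ := Ideal.mem_span_singleton'.1 h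
    have h2 := congrArg (fun t => (paperCoeff k t).snd.2) hr
    simp only [map_mul, paperCoeff_x, paperCoeff_y] at h2
    simp at h2

lemma paper_not_badElt (α β : ℕ) :
    ¬ BadElt (PaperRing.x k) (PaperRing.y k)
      ((Fin α → PaperRing k) × (Fin β → PaperResidue k)) := by
  rintro ⟨⟨u, v⟩, h1, h2⟩
  apply h2
  have h3 := congrArg Prod.fst h1
  refine Prod.ext ?_ ?_
  · funext i
    have h4 : PaperRing.x k * u i = 0 := congrFun h3 i
    have h5 := (paper_H2 k (u i) 0 (by rw [h4, mul_zero, add_zero])).1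
    exact (paper_H1 k _ h5).2
  · funext j
    change PaperRing.y k • v j = 0
    obtain ⟨r, hr⟩ := Submodule.Quotient.mk_surjective _ (v j)
    rw [← hr, ← Submodule.Quotient.mk_smul, Submodule.Quotient.mk_eq_zero]
    exact Ideal.mul_mem_right _ _ (Ideal.subset_span (by simp))

end PaperRingLemmas

set_option synthInstance.maxHeartbeats 1000000 in
set_option maxHeartbeats 1000000 in
theorem paperModN_not_finiteRedGdim (k : Type u) [Field k] :
    (¬ ∃ α β : ℕ, Nonempty
      (PaperModN k ≃ₗ[PaperRing k] (Fin α → PaperRing k) × (Fin β → PaperResidue k))) ∧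
    ¬ FiniteRedGdim (PaperRing k) (ModuleCat.of (PaperRing k) (PaperModN k)) := by
  refine ⟨?_, ?_⟩
  · rintro ⟨α, β, ⟨e⟩⟩
    exact paper_not_badElt k α β ((paper_badElt k).of_injective e.toLinearMap e.injective)
  · refine not_finiteRedGdim_of_badElt (paper_H1 k) (paper_H2 k) (paper_H3 k) (paperTheta k)
      ?_ ?_ _ (paper_badElt k)
    · intro h
      change paperC k (paperCoeff k (PaperRing.x k)).snd.1 * PaperRing.x k = _
      rw [paperCoeff_x, TrivSqZeroExt.snd_inr, map_one, one_mul]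
    · intro h
      change paperC k (paperCoeff k (PaperRing.y k)).snd.1 * PaperRing.x k = _
      rw [paperCoeff_y, TrivSqZeroExt.snd_inr, map_zero, zero_mul]
end
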